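/- Let α > 1, Φ(u) = |u|^{α-1}sgn(u). Assume p is regularly varying of index δ > -1, and assume the half-linear delay equation (rΦ(y'))' = pΦ(y∘τ) with τ(t) ≍ t has an eventually positive increasing solution y that is slowly varying with y(τ(t)) ~ y(t). Then r(t)Φ(y'(t)) ~ (1/(δ+1)) t p(t) y(t)^{α-1} as t → ∞, and consequently y'(t)/y(t) = (1+o(1)) (t p(t)/((δ+1)r(t)))^{β-1} as t → ∞, where β is the conjugate exponent of α. -/

import Mathlib

open Filter Real

/-- `f` is regularly varying (at infinity) of index `θ`. -/
def RegVary (f : ℝ → ℝ) (θ : ℝ) : Prop :=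
  ∀ l : ℝ, 0 < l → Filter.Tendsto (fun t => f (l * t) / f t) Filter.atTop (nhds (l ^ θ))

/-- The half-linear power function `Φ(u) = |u|^(α-1) sgn u`. -/
noncomputable def phi (α u : ℝ) : ℝ := |u| ^ (α - 1) * Real.sign u

lemma ev_mono (F f : ℝ → ℝ) (hF : ∀ᶠ t in atTop, HasDerivAt F (f t) t)
    (hf : ∀ᶠ t in atTop, 0 ≤ f t) : ∃ T, MonotoneOn F (Set.Ici T) := by
  obtain ⟨T, hT⟩ := eventually_atTop.1 (hF.and hf)
  refine ⟨T, monotoneOn_of_deriv_nonneg (convex_Ici T) ?_ ?_ ?_⟩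
  · intro x hx
    exact (hT x hx).1.continuousAt.continuousWithinAt
  · intro x hx
    rw [interior_Ici] at hx
    exact (hT x (le_of_lt hx)).1.differentiableAt.differentiableWithinAt
  · intro x hx
    rw [interior_Ici] at hx
    rw [(hT x (le_of_lt hx)).1.deriv]
    exact (hT x (le_of_lt hx)).2

lemma lhop_upper (F G f g : ℝ → ℝ) (c : ℝ)
    (hF : ∀ᶠ t in atTop, HasDerivAt F (f t) t)
    (hG : ∀ᶠ t in atTop, HasDerivAt G (g t) t)
    (hg : ∀ᶠ t in atTop, 0 < g t)
    (hlim : Tendsto (fun t => f t / g t) atTop (nhds c))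
    (hGt : Tendsto G atTop atTop) (ε : ℝ) (hε : 0 < ε) :
    ∀ᶠ t in atTop, F t / G t < c + ε := by
  have h1 : ∀ᶠ t in atTop, f t / g t < c + ε / 2 :=
    hlim.eventually (gt_mem_nhds (by linarith))
  obtain ⟨T, hT⟩ := ev_mono (fun t => (c + ε / 2) * G t - F t)
    (fun t => (c + ε / 2) * g t - f t)
    (by filter_upwards [hF, hG] with t a b
        exact (b.const_mul _).sub a)
    (by filter_upwards [h1, hg] with t a b
        rw [div_lt_iff₀ b] at a
        linarith)
  set K := (c + ε / 2) * G T - F T with hK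
  filter_upwards [hGt.eventually_gt_atTop 0, hGt.eventually_gt_atTop (-K / (ε / 2)),
    eventually_ge_atTop T] with t a b d
  rw [div_lt_iff₀ a]
  rw [div_lt_iff₀ (by linarith)] at b
  have := hT (Set.self_mem_Ici) d d
  simp only at this
  nlinarith

lemma lhop (F G f g : ℝ → ℝ) (c : ℝ)
    (hF : ∀ᶠ t in atTop, HasDerivAt F (f t) t)
    (hG : ∀ᶠ t in atTop, HasDerivAt G (g t) t)
    (hg : ∀ᶠ t in atTop, 0 < g t)
    (hlim : Tendsto (fun t => f t / g t) atTop (nhds c))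
    (hGt : Tendsto G atTop atTop) :
    Tendsto (fun t => F t / G t) atTop (nhds c) := by
  rw [Metric.tendsto_nhds]
  intro ε hε
  have h2 := lhop_upper (fun t => - F t) G (fun t => - f t) g (-c)
    (by filter_upwards [hF] with t a using a.neg) hG hg
    (by simpa [neg_div] using hlim.neg) hGt ε hε
  filter_upwards [lhop_upper F G f g c hF hG hg hlim hGt ε hε, h2] with t a b
  rw [Real.dist_eq, abs_lt]
  rw [neg_div] at b
  constructor <;> linarith

lemma tendsto_mul_left_atTop (l : ℝ) (hl : 0 < l) :
    Tendsto (fun t : ℝ => l * t) atTop atTop := tendsto_id.const_mul_atTop hl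

lemma deriv_scale (F f : ℝ → ℝ) (l t : ℝ) (h : HasDerivAt F (f (l * t)) (l * t)) :
    HasDerivAt (fun s => F (l * s)) (l * f (l * t)) t := by
  have h2 : HasDerivAt (fun s => l * s) l t := by
    simpa using (hasDerivAt_id t).const_mul l
  have := HasDerivAt.comp t h h2
  rw [mul_comm]
  exact this

lemma F_top (F f : ℝ → ℝ) (δ : ℝ) (hδ : -1 < δ)
    (hF : ∀ᶠ t in atTop, HasDerivAt F (f t) t)
    (hf : ∀ᶠ t in atTop, 0 < f t) (hRV : RegVary f δ) : Tendsto F atTop atTop := by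
  have hs := tendsto_mul_left_atTop 2 two_pos
  have h1 : ∀ᶠ t in atTop, (1:ℝ)/2 < f (2 * t) / f t := by
    refine (hRV 2 two_pos).eventually (lt_mem_nhds ?_)
    have : (2:ℝ) ^ (-1:ℝ) < 2 ^ δ := Real.rpow_lt_rpow_of_exponent_lt (by norm_num) hδ
    rw [Real.rpow_neg_one] at this
    linarith
  obtain ⟨T, hT⟩ := ev_mono (fun t => F (2 * t) - F t) (fun t => 2 * f (2 * t) - f t)
    (by filter_upwards [hF, hs.eventually hF] with t a b
        exact (deriv_scale F f 2 t b).sub a)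
    (by filter_upwards [h1, hf] with t a b
        rw [lt_div_iff₀ b] at a
        linarith)
  obtain ⟨T1, hT1⟩ := eventually_atTop.1 (hF.and hf)
  have hst : StrictMonoOn F (Set.Ici T1) := by
    refine strictMonoOn_of_deriv_pos (convex_Ici T1) ?_ ?_
    · intro x hx
      exact (hT1 x hx).1.continuousAt.continuousWithinAt
    · intro x hx
      rw [interior_Ici] at hx
      rw [(hT1 x (le_of_lt hx)).1.deriv]
      exact (hT1 x (le_of_lt hx)).2
  set S := max (max T T1) 1 with hS
  have hST : T ≤ S := le_trans (le_max_left _ _) (le_max_left _ _)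
  have hST1 : T1 ≤ S := le_trans (le_max_right _ _) (le_max_left _ _)
  have hS1 : 1 ≤ S := le_max_right _ _
  have hD : 0 < F (2 * S) - F S := by
    have := hst (show T1 ≤ S from hST1) (show T1 ≤ 2 * S by linarith) (show S < 2 * S by linarith)
    linarith
  have hmono : Monotone (fun t => F (max S t)) := by
    intro a b hab
    exact hst.monotoneOn (le_trans hST1 (le_max_left _ _)) (le_trans hST1 (le_max_left _ _))
      (max_le_max le_rfl hab)
  have heq : (fun t => F (max S t)) =ᶠ[atTop] F := by
    filter_upwards [eventually_ge_atTop S] with t ht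
    simp [max_eq_right ht]
  rcases tendsto_atTop_of_monotone hmono with h | ⟨L, h⟩
  · exact h.congr' heq
  · exfalso
    have hL : Tendsto F atTop (nhds L) := h.congr' heq
    have h0 : Tendsto (fun t => F (2 * t) - F t) atTop (nhds (L - L)) := (hL.comp hs).sub hL
    have : F (2 * S) - F S ≤ L - L := by
      refine ge_of_tendsto h0 ?_
      filter_upwards [eventually_ge_atTop S] with t ht
      exact hT hST (le_trans hST ht) ht
    linarith

lemma F_RV (F f : ℝ → ℝ) (δ : ℝ) (hδ : -1 < δ)
    (hF : ∀ᶠ t in atTop, HasDerivAt F (f t) t)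
    (hf : ∀ᶠ t in atTop, 0 < f t) (hRV : RegVary f δ) : RegVary F (δ + 1) := by
  intro l hl
  have hs := tendsto_mul_left_atTop l hl
  refine lhop (fun t => F (l * t)) F (fun t => l * f (l * t)) f _ ?_ hF hf ?_
    (F_top F f δ hδ hF hf hRV)
  · filter_upwards [hs.eventually hF] with t b using deriv_scale F f l t b
  · have := (hRV l hl).const_mul l
    rw [Real.rpow_add_one hl.ne', mul_comm]
    simpa [mul_div_assoc] using this

/-- integrability and value of the integral of a scaled nonnegative derivative -/
lemma scaled_int (F f : ℝ → ℝ) (T t : ℝ) (hT1 : 0 < T)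
    (h : ∀ s ≥ T, HasDerivAt F (f s) s ∧ 0 < f s) (ht : T ≤ t) :
    IntervalIntegrable (fun u => t * f (t * u)) MeasureTheory.volume 1 2 ∧
    ∫ u in (1:ℝ)..2, t * f (t * u) = F (2 * t) - F t := by
  have ht0 : 0 < t := by linarith
  have hge : ∀ u : ℝ, 1 ≤ u → T ≤ t * u := fun u hu => by nlinarith
  have hd : ∀ u : ℝ, 1 ≤ u → HasDerivAt (fun s => F (t * s)) (t * f (t * u)) u := fun u hu =>
    deriv_scale F f t u (h _ (hge u hu)).1
  have hi : IntervalIntegrable (fun u => t * f (t * u)) MeasureTheory.volume 1 2 := by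
    refine intervalIntegral.intervalIntegrable_deriv_of_nonneg (g := fun s => F (t * s)) ?_ ?_ ?_
    · intro x hx
      rw [Set.uIcc_of_le (by norm_num)] at hx
      exact (hd x hx.1).continuousAt.continuousWithinAt
    · intro x hx
      rw [min_eq_left (by norm_num)] at hx
      exact hd x hx.1.le
    · intro x hx
      rw [min_eq_left (by norm_num)] at hx
      exact (mul_pos ht0 (h _ (hge x hx.1.le)).2).le
  refine ⟨hi, ?_⟩
  rw [intervalIntegral.integral_eq_sub_of_hasDerivAt (f := fun s => F (t * s)) ?_ hi]
  · simp [mul_comm]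
  · intro x hx
    rw [Set.uIcc_of_le (by norm_num)] at hx
    exact hd x hx.1

lemma h_bdd (F f : ℝ → ℝ) (δ : ℝ) (hδ : -1 < δ)
    (hF : ∀ᶠ t in atTop, HasDerivAt F (f t) t)
    (hf : ∀ᶠ t in atTop, 0 < f t) (hRV : RegVary f δ) :
    ∃ M, ∀ᶠ t in atTop, t * f t / F t ≤ M := by
  have hFt := F_top F f δ hδ hF hf hRV
  obtain ⟨T0, hT0⟩ := eventually_atTop.1 (hF.and hf)
  set T := max T0 1
  have hT1 : 0 < T := lt_of_lt_of_le one_pos (le_max_right _ _)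
  have hT : ∀ s ≥ T, HasDerivAt F (f s) s ∧ 0 < f s := fun s hs => hT0 s (le_trans (le_max_left _ _) hs)
  have hlim : Tendsto (fun t => ∫ u in (1:ℝ)..2, min (f (t * u) / f t) 1) atTop
      (nhds (∫ u in (1:ℝ)..2, min (u ^ δ) 1)) := by
    refine intervalIntegral.tendsto_integral_filter_of_dominated_convergence (fun _ => 1) ?_ ?_
      intervalIntegrable_const ?_
    · filter_upwards [eventually_ge_atTop T] with t ht
      have hi := (scaled_int F f T t hT1 hT ht).1
      have h1 := (hi.const_mul (1 / (t * f t))).aestronglyMeasurable_restrict_uIoc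
      have ht0 : 0 < t := by linarith
      have h2 : (fun u => 1 / (t * f t) * (t * f (t * u))) = fun u => f (t * u) / f t := by
        funext u
        have := (hT t ht).2.ne'
        field_simp
      rw [h2] at h1
      exact h1.inf MeasureTheory.aestronglyMeasurable_const
    · filter_upwards [eventually_ge_atTop T] with t ht
      refine Eventually.of_forall fun u hu => ?_
      rw [Set.uIoc_of_le (by norm_num)] at hu
      have h3 : 0 < f (t * u) / f t := by
        refine div_pos (hT _ ?_).2 (hT t ht).2
        have := hu.1
        show T ≤ t * u
        nlinarith
      rw [Real.norm_eq_abs, abs_of_nonneg (le_min h3.le zero_le_one)]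
      exact min_le_right _ _
    · refine Eventually.of_forall fun u hu => ?_
      rw [Set.uIoc_of_le (by norm_num)] at hu
      have := (hRV u (by linarith [hu.1])).min (tendsto_const_nhds (x := (1:ℝ)))
      simpa [mul_comm] using this
  have hc : 0 < ∫ u in (1:ℝ)..2, min (u ^ δ) 1 := by
    refine intervalIntegral.intervalIntegral_pos_of_pos_on ?_ ?_ (by norm_num)
    · refine ContinuousOn.intervalIntegrable ?_
      intro x hx
      rw [Set.uIcc_of_le (by norm_num)] at hx
      have hc1 : ContinuousAt (fun u : ℝ => min (u ^ δ) 1) x :=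
        Filter.Tendsto.min (Real.continuousAt_rpow_const x δ (Or.inl (by linarith [hx.1])))
          (tendsto_const_nhds (x := (1:ℝ)))
      exact hc1.continuousWithinAt
    · intro x hx
      exact lt_min (Real.rpow_pos_of_pos (by linarith [hx.1]) _) one_pos
  set c := ∫ u in (1:ℝ)..2, min (u ^ δ) 1 with hcdef
  have hev : ∀ᶠ t in atTop, c / 2 < ∫ u in (1:ℝ)..2, min (f (t * u) / f t) 1 :=
    hlim.eventually (lt_mem_nhds (by linarith))
  have hFR := F_RV F f δ hδ hF hf hRV 2 two_pos
  have hev2 : ∀ᶠ t in atTop, F (2 * t) / F t < 2 ^ (δ + 1) + 1 :=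
    hFR.eventually (gt_mem_nhds (by linarith))
  refine ⟨(2 ^ (δ + 1)) / (c / 2), ?_⟩
  filter_upwards [hev, hev2, eventually_ge_atTop T, hFt.eventually_gt_atTop 0] with t a b ht hFp
  have ht0 : 0 < t := by linarith
  have hft := (hT t ht).2
  obtain ⟨hi, he⟩ := scaled_int F f T t hT1 hT ht
  have h2 : (fun u => 1 / (t * f t) * (t * f (t * u))) = fun u => f (t * u) / f t := by
    funext u
    field_simp
  have hi2 : IntervalIntegrable (fun u => f (t * u) / f t) MeasureTheory.volume 1 2 := by
    rw [← h2]; exact hi.const_mul _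
  have hle : ∫ u in (1:ℝ)..2, min (f (t * u) / f t) 1 ≤ ∫ u in (1:ℝ)..2, f (t * u) / f t := by
    refine intervalIntegral.integral_mono_on (by norm_num) ?_ hi2 ?_
    · have hk : IntervalIntegrable (fun _ : ℝ => (1:ℝ)) MeasureTheory.volume 1 2 :=
        intervalIntegrable_const
      exact ⟨hi2.1.inf hk.1, hi2.2.inf hk.2⟩
    · intro x _
      exact min_le_left _ _
  have he2 : ∫ u in (1:ℝ)..2, f (t * u) / f t = (F (2 * t) - F t) / (t * f t) := by
    rw [← h2, intervalIntegral.integral_const_mul, he]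
    ring
  rw [he2] at hle
  have h5 : c / 2 < (F (2 * t) - F t) / (t * f t) := lt_of_lt_of_le a hle
  rw [lt_div_iff₀ (by positivity)] at h5
  rw [div_lt_iff₀ hFp] at b
  rw [div_le_div_iff₀ hFp (by linarith)]
  linarith

lemma karamata (F f : ℝ → ℝ) (δ : ℝ) (hδ : -1 < δ)
    (hF : ∀ᶠ t in atTop, HasDerivAt F (f t) t)
    (hf : ∀ᶠ t in atTop, 0 < f t) (hRV : RegVary f δ) :
    Tendsto (fun t => t * f t / F t) atTop (nhds (δ + 1)) := by
  have hFt := F_top F f δ hδ hF hf hRV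
  have hFR := F_RV F f δ hδ hF hf hRV
  obtain ⟨M, hM⟩ := h_bdd F f δ hδ hF hf hRV
  obtain ⟨T0, hT0⟩ := eventually_atTop.1 (((hF.and hf).and (hFt.eventually_gt_atTop 0)).and hM)
  set T := max T0 1
  have hT1 : 0 < T := lt_of_lt_of_le one_pos (le_max_right _ _)
  have hT : ∀ s ≥ T, ((HasDerivAt F (f s) s ∧ 0 < f s) ∧ 0 < F s) ∧ s * f s / F s ≤ M :=
    fun s hs => hT0 s (le_trans (le_max_left _ _) hs)
  set h : ℝ → ℝ := fun t => t * f t / F t with hh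
  have hpos : ∀ s ≥ T, 0 < h s := fun s hs =>
    div_pos (mul_pos (by linarith) (hT s hs).1.1.2) (hT s hs).1.2
  have hle : ∀ s ≥ T, h s ≤ M := fun s hs => (hT s hs).2
  have hlog : ∀ s ≥ T, HasDerivAt (fun s => Real.log (F s)) (f s / F s) s ∧ 0 < f s / F s :=
    fun s hs => ⟨(hT s hs).1.1.1.log (hT s hs).1.2.ne', div_pos (hT s hs).1.1.2 (hT s hs).1.2⟩
  -- `h` is slowly varying
  have hsv : ∀ u : ℝ, 0 < u → Tendsto (fun t => h (t * u) / h t) atTop (nhds 1) := by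
    intro u hu
    have h1 := ((hRV u hu).const_mul u).div (hFR u hu) (Real.rpow_pos_of_pos hu _).ne'
    rw [Real.rpow_add_one hu.ne', mul_comm (u ^ δ), div_self (by positivity)] at h1
    refine h1.congr' ?_
    filter_upwards [eventually_ge_atTop T,
      (tendsto_mul_left_atTop u hu).eventually (eventually_ge_atTop T)] with t a b
    have x1 := (hT t a).1.1.2.ne'
    have x2 := (hT t a).1.2.ne'
    have x3 := (hT _ b).1.2.ne'
    have ht0 : t ≠ 0 := by linarith
    simp only [hh, mul_comm t u, Pi.div_apply]
    field_simp
  have hdiff : ∀ u : ℝ, 0 < u → Tendsto (fun t => h (t * u) - h t) atTop (nhds 0) := by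
    intro u hu
    have h1 : Tendsto (fun t => h (t * u) / h t - 1) atTop (nhds 0) := by
      simpa using (hsv u hu).sub_const 1
    have h2 : Tendsto (fun t => M * |h (t * u) / h t - 1|) atTop (nhds 0) := by
      simpa using h1.abs.const_mul M
    refine squeeze_zero_norm' ?_ h2
    filter_upwards [eventually_ge_atTop T] with t a
    have hp := hpos t a
    have : h (t * u) - h t = h t * (h (t * u) / h t - 1) := by
      field_simp
    rw [this, norm_mul, Real.norm_eq_abs, Real.norm_eq_abs, abs_of_pos hp]
    exact mul_le_mul_of_nonneg_right (hle t a) (abs_nonneg _)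
  have hint : ∀ t ≥ T, IntervalIntegrable (fun u => h (t * u) / u) MeasureTheory.volume 1 2 ∧
      ∫ u in (1:ℝ)..2, h (t * u) / u = Real.log (F (2 * t)) - Real.log (F t) := by
    intro t ht
    obtain ⟨h1, h2⟩ := scaled_int _ _ T t hT1 hlog ht
    have hE : Set.EqOn (fun u => t * (f (t * u) / F (t * u))) (fun u => h (t * u) / u)
        (Set.uIcc 1 2) := by
      intro u hu
      rw [Set.uIcc_of_le (by norm_num)] at hu
      have hu0 : u ≠ 0 := by linarith [hu.1]
      simp only [hh]
      field_simp
    exact ⟨h1.congr (hE.mono Set.uIoc_subset_uIcc), by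
      rw [← h2]; exact (intervalIntegral.integral_congr hE).symm⟩
  have hinv : IntervalIntegrable (fun u : ℝ => 1 / u) MeasureTheory.volume 1 2 := by
    refine ContinuousOn.intervalIntegrable ?_
    intro x hx
    rw [Set.uIcc_of_le (by norm_num)] at hx
    have : x ≠ 0 := by linarith [hx.1]
    exact (continuousAt_const.div continuousAt_id this).continuousWithinAt
  have hI2 : ∀ t, ∫ u in (1:ℝ)..2, h t * (1 / u) = h t * Real.log 2 := by
    intro t
    rw [intervalIntegral.integral_const_mul, integral_one_div_of_pos one_pos two_pos]
    simp
  have hlim : Tendsto (fun t => ∫ u in (1:ℝ)..2, (h (t * u) / u - h t * (1 / u))) atTop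
      (nhds (∫ u in (1:ℝ)..2, (0:ℝ))) := by
    refine intervalIntegral.tendsto_integral_filter_of_dominated_convergence (fun _ => M) ?_ ?_
      intervalIntegrable_const ?_
    · filter_upwards [eventually_ge_atTop T] with t ht
      exact ((hint t ht).1.sub (hinv.const_mul (h t))).aestronglyMeasurable_restrict_uIoc
    · filter_upwards [eventually_ge_atTop T] with t ht
      refine Eventually.of_forall fun u hu => ?_
      rw [Set.uIoc_of_le (by norm_num)] at hu
      have hu1 := hu.1
      have htu : T ≤ t * u := by nlinarith
      have e : h (t * u) / u - h t * (1 / u) = (h (t * u) - h t) / u := by ring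
      have b1 : |h (t * u) - h t| ≤ M := by
        rw [abs_le]
        constructor <;> linarith [hpos _ htu, hpos t ht, hle _ htu, hle t ht]
      rw [e, Real.norm_eq_abs, abs_div, abs_of_pos (show 0 < u by linarith)]
      exact (div_le_self (abs_nonneg _) hu1.le).trans b1
    · refine Eventually.of_forall fun u hu => ?_
      rw [Set.uIoc_of_le (by norm_num)] at hu
      have := (hdiff u (by linarith [hu.1])).div_const u
      rw [zero_div] at this
      refine this.congr fun t => ?_
      ring
  have hlim2 : Tendsto (fun t => Real.log (F (2 * t) / F t) - h t * Real.log 2) atTop (nhds 0) := by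
    rw [intervalIntegral.integral_zero] at hlim
    refine hlim.congr' ?_
    filter_upwards [eventually_ge_atTop T] with t ht
    rw [intervalIntegral.integral_sub (hint t ht).1 (hinv.const_mul (h t)), (hint t ht).2, hI2,
      Real.log_div (hT _ (show 2 * t ≥ T by linarith)).1.2.ne' (hT t ht).1.2.ne']
  have hlim3 : Tendsto (fun t => Real.log (F (2 * t) / F t)) atTop (nhds ((δ + 1) * Real.log 2)) := by
    have := (hFR 2 two_pos).log (Real.rpow_pos_of_pos two_pos _).ne'
    rwa [Real.log_rpow two_pos] at this
  have hl2 : Real.log 2 ≠ 0 := (Real.log_pos one_lt_two).ne'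
  have hfin := (hlim3.sub hlim2).div_const (Real.log 2)
  rw [sub_zero, mul_div_assoc, div_self hl2, mul_one] at hfin
  refine hfin.congr fun t => ?_
  field_simp
  ring

lemma phi_pos_eq (α u : ℝ) (hu : 0 < u) : phi α u = u ^ (α - 1) := by
  rw [phi, abs_of_pos hu, Real.sign_of_pos hu, mul_one]

theorem quasiderivative_asymptotics (α β δ : ℝ) (hα : 1 < α)
    (hβ : 1 / α + 1 / β = 1) (hδ : -1 < δ)
    (r p τ y y' : ℝ → ℝ)
    (hr : ∀ t, 0 < r t) (hp : ∀ t, 0 < p t) (hpc : Continuous p)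
    (hpv : RegVary p δ)
    (hτ : ∃ c d : ℝ, 0 < c ∧ c < d ∧ ∀ᶠ t in atTop, c ≤ τ t / t ∧ τ t / t ≤ d)
    (hypos : ∀ᶠ t in atTop, 0 < y t) (hy'pos : ∀ᶠ t in atTop, 0 < y' t)
    (hy : ∀ᶠ t in atTop, HasDerivAt y (y' t) t)
    (heq : ∀ᶠ t in atTop,
      HasDerivAt (fun s => r s * phi α (y' s)) (p t * phi α (y (τ t))) t)
    (hSV : RegVary y 0)
    (hyτ : Tendsto (fun t => y (τ t) / y t) atTop (nhds 1)) :
    Tendsto (fun t => (r t * phi α (y' t)) / ((1 / (δ + 1)) * t * p t * (y t) ^ (α - 1)))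
      atTop (nhds 1) ∧
    Tendsto (fun t => (y' t / y t) / ((t * p t / ((δ + 1) * r t)) ^ (β - 1)))
      atTop (nhds 1) := by
  have hα1 : 0 < α - 1 := by linarith
  have hrat : ∀ᶠ t in atTop, 0 < y (τ t) / y t := hyτ.eventually (lt_mem_nhds one_pos)
  have hyτpos : ∀ᶠ t in atTop, 0 < y (τ t) := by
    filter_upwards [hrat, hypos] with t a b
    exact (div_pos_iff_of_pos_right b).1 a
  have hf : ∀ᶠ t in atTop, 0 < p t * phi α (y (τ t)) := by
    filter_upwards [hyτpos] with t a
    rw [phi_pos_eq _ _ a]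
    exact mul_pos (hp t) (Real.rpow_pos_of_pos a _)
  have hRV : RegVary (fun t => p t * phi α (y (τ t))) δ := by
    intro l hl
    have hs := tendsto_mul_left_atTop l hl
    have h1 := ((hyτ.comp hs).mul (hSV l hl)).mul (hyτ.inv₀ one_ne_zero)
    have h2 := (hpv l hl).mul (h1.rpow_const (p := α - 1) (Or.inl (by simp)))
    simp only [Real.rpow_zero, inv_one, mul_one, Real.one_rpow] at h2
    refine h2.congr' ?_
    filter_upwards [hyτpos, hs.eventually hyτpos, hypos, hs.eventually hypos] with t a b c d
    rw [phi_pos_eq _ _ a, phi_pos_eq _ _ b, mul_div_mul_comm, ← Real.div_rpow b.le a.le]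
    congr 2
    simp only [Function.comp]
    field_simp
  have hK := karamata _ _ δ hδ heq hf hRV
  have hδ1 : 0 < δ + 1 := by linarith
  have hA : Tendsto (fun t => (r t * phi α (y' t)) / ((1 / (δ + 1)) * t * p t * (y t) ^ (α - 1)))
      atTop (nhds 1) := by
    have h1 := (hK.inv₀ hδ1.ne').mul ((hyτ.rpow_const (p := α - 1) (Or.inl one_ne_zero)).const_mul (δ + 1))
    rw [Real.one_rpow, mul_one, inv_mul_cancel₀ hδ1.ne'] at h1
    refine h1.congr' ?_
    filter_upwards [hyτpos, hypos, hy'pos, eventually_gt_atTop 0] with t a b c ht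
    rw [phi_pos_eq _ _ a, phi_pos_eq _ _ c, Real.div_rpow a.le b.le]
    have x1 := (Real.rpow_pos_of_pos a (α - 1)).ne'
    have x2 := (Real.rpow_pos_of_pos b (α - 1)).ne'
    have x3 := (Real.rpow_pos_of_pos c (α - 1)).ne'
    have x4 := (hp t).ne'
    have x5 := (hr t).ne'
    field_simp
  refine ⟨hA, ?_⟩
  have hβ0 : β ≠ 0 := by
    rintro rfl
    rw [div_zero, add_zero, div_eq_one_iff_eq (by linarith)] at hβ
    linarith
  have hαβ : (α - 1) * (β - 1) = 1 := by
    have : α ≠ 0 := by linarith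
    field_simp at hβ
    linarith
  have h1 := hA.rpow_const (p := β - 1) (Or.inl one_ne_zero)
  rw [Real.one_rpow] at h1
  refine h1.congr' ?_
  filter_upwards [hypos, hy'pos, eventually_gt_atTop 0] with t b c ht
  have x4 := hp t
  have x5 := hr t
  have e : r t * phi α (y' t) / (1 / (δ + 1) * t * p t * y t ^ (α - 1))
      = (y' t / y t) ^ (α - 1) / (t * p t / ((δ + 1) * r t)) := by
    rw [phi_pos_eq _ _ c, Real.div_rpow c.le b.le]
    have x2 := (Real.rpow_pos_of_pos b (α - 1)).ne'
    field_simp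
  rw [e, Real.div_rpow (by positivity) (by positivity), ← Real.rpow_mul (by positivity), hαβ,
    Real.rpow_one]
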